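/- For all h, x ∈ ℤ^n, all N ∈ ℤ_{≥0}^n and each i ∈ {1,…,n}: χ̄^{p',p}_{h,x}[N] = q^{N_i} · χ̄^{p',p}_{h+e_i, x}[N] + (1 − q^{|N|}) · χ̄^{p',p}_{h,x}[N − 1_i], where e_i = 1_i is the i-th standard basis vector of ℤ^n. (Replacing h by h + e_i corresponds to replacing the weight η by η − ω_{i−1} + ω_i.) -/

import Mathlib

open scoped BigOperators Classical

/-- Characters live in formal Laurent series over `ℚ`. -/
abbrev LS : Type := LaurentSeries ℚ

/-- `q^e` for `e : ℤ`. -/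
noncomputable def qpow (e : ℤ) : LS := HahnSeries.single e 1
/-- The number of inversions (the length) of a permutation. -/
def lexp {n : ℕ} (σ : Equiv.Perm (Fin n)) : ℕ :=
  (Finset.univ.filter fun p : Fin n × Fin n => p.1 < p.2 ∧ σ p.2 < σ p.1).card

/-- `S_n` acts on `ℤ^n` by permuting coordinates: `(σ • x)_i = x_{σ⁻¹ i}`. -/
def pact {n : ℕ} (σ : Equiv.Perm (Fin n)) (x : Fin n → ℤ) : Fin n → ℤ := fun i => x (σ⁻¹ i)

/-- `E(σ,α) = (p'p/2)(α,α) + (p'σ(x) - p h, α) + (x - σ(x), h)`. -/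
def Ewt {n : ℕ} (p' p : ℤ) (h x : Fin n → ℤ) (σ : Equiv.Perm (Fin n)) (α : Fin n → ℤ) : ℤ :=
  p' * p * (∑ i, α i * α i) / 2 + (∑ i, (p' * pact σ x i - p * h i) * α i)
    + ∑ i, (x i - pact σ x i) * h i

/-- `v(σ,α) = σ(x) - x + pα`. -/
def vwt {n : ℕ} (p : ℤ) (x : Fin n → ℤ) (σ : Equiv.Perm (Fin n)) (α : Fin n → ℤ) : Fin n → ℤ :=
  fun i => pact σ x i - x i + p * α i

/-- `(q)_m = Π_{i=1}^m (1 - q^i)` (equal to `1` for `m ≤ 0`). -/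
noncomputable def pochZ (m : ℤ) : LS := ∏ i ∈ Finset.range m.toNat, (1 - qpow ((i : ℤ) + 1))

/-- `1/(q)_m`, with the convention that it is `0` for `m < 0`. -/
noncomputable def invPoch (m : ℤ) : LS := if m < 0 then 0 else (pochZ m)⁻¹

/-- The finitized `W_n` character `χ̄^{p',p}_{h,x}[N]`. -/
noncomputable def chibarN (n : ℕ) (p' p : ℤ) (h x : Fin n → ℤ) (N : Fin n → ℤ) : LS :=
  ∑ σ : Equiv.Perm (Fin n), ∑ᶠ (α : Fin n → ℤ) (_ : ∑ i, α i = 0),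
    (-1 : LS) ^ lexp σ * qpow (Ewt p' p h x σ α) * pochZ (∑ i, N i) *
      ∏ i, invPoch (N i - vwt p x σ α i)

theorem qpow_zero : qpow 0 = 1 := rfl

theorem qpow_add (a b : ℤ) : qpow (a + b) = qpow a * qpow b := by
  simp [qpow]

theorem qpow_ne_zero (e : ℤ) : qpow e ≠ 0 := by
  simp [qpow]

theorem one_sub_qpow_ne_zero {e : ℤ} (he : e ≠ 0) : 1 - qpow e ≠ 0 := by
  intro H
  have := congrArg (fun f : LS => HahnSeries.coeff f 0) H
  simp [qpow, HahnSeries.coeff_single_of_ne he.symm] at this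

theorem pochZ_ne_zero (m : ℤ) : pochZ m ≠ 0 :=
  Finset.prod_ne_zero_iff.mpr fun i _ => one_sub_qpow_ne_zero (by positivity)

theorem pochZ_eq_mul_pochZ_sub_one {m : ℤ} (hm : 0 < m) :
    pochZ m = (1 - qpow m) * pochZ (m - 1) := by
  obtain ⟨k, rfl⟩ : ∃ k : ℕ, m = k + 1 := ⟨(m - 1).toNat, by omega⟩
  have h1 : ((k : ℤ) + 1).toNat = k + 1 := by omega
  have h2 : ((k : ℤ) + 1 - 1).toNat = k := by omega
  rw [pochZ, pochZ, h1, h2, Finset.prod_range_succ, mul_comm]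

theorem invPoch_of_neg {m : ℤ} (hm : m < 0) : invPoch m = 0 := if_pos hm

theorem invPoch_sub_one (m : ℤ) : invPoch (m - 1) = (1 - qpow m) * invPoch m := by
  rcases lt_trichotomy m 0 with hm | rfl | hm
  · rw [invPoch_of_neg hm, invPoch_of_neg (by omega), mul_zero]
  · rw [invPoch_of_neg (by omega), qpow_zero, sub_self, zero_mul]
  · rw [invPoch, invPoch, if_neg (by omega), if_neg (by omega), pochZ_eq_mul_pochZ_sub_one hm,
      mul_inv, mul_inv_cancel_left₀ (one_sub_qpow_ne_zero hm.ne')]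

theorem prod_invPoch_eq_zero_of_sum_neg {n : ℕ} {m : Fin n → ℤ} (hm : ∑ j, m j < 0) :
    ∏ j, invPoch (m j) = 0 := by
  obtain ⟨j, hj, hneg⟩ := Finset.exists_lt_of_sum_lt (s := Finset.univ) (f := m)
    (g := fun _ => 0) (by simpa using hm)
  exact Finset.prod_eq_zero hj (invPoch_of_neg hneg)

theorem prod_invPoch_sub_single {n : ℕ} (m : Fin n → ℤ) (i : Fin n) :
    ∏ j, invPoch (m j - if j = i then 1 else 0) = (1 - qpow (m i)) * ∏ j, invPoch (m j) := by
  rw [← Finset.mul_prod_erase _ _ (Finset.mem_univ i),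
    ← Finset.mul_prod_erase _ (fun j => invPoch (m j)) (Finset.mem_univ i), if_pos rfl,
    invPoch_sub_one, mul_assoc]
  congr 2
  refine Finset.prod_congr rfl fun j hj => ?_
  rw [if_neg (Finset.ne_of_mem_erase hj), sub_zero]

theorem sum_pact {n : ℕ} (σ : Equiv.Perm (Fin n)) (x : Fin n → ℤ) :
    ∑ j, pact σ x j = ∑ j, x j :=
  Equiv.sum_comp σ⁻¹ x

theorem sum_vwt {n : ℕ} (p : ℤ) (x : Fin n → ℤ) (σ : Equiv.Perm (Fin n)) {α : Fin n → ℤ}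
    (hα : ∑ j, α j = 0) : ∑ j, vwt p x σ α j = 0 := by
  simp [vwt, Finset.sum_add_distrib, Finset.sum_sub_distrib, sum_pact, ← Finset.mul_sum, hα]

theorem Ewt_add_single {n : ℕ} (p' p : ℤ) (h x : Fin n → ℤ) (σ : Equiv.Perm (Fin n))
    (α : Fin n → ℤ) (i : Fin n) :
    Ewt p' p (fun j => h j + if j = i then 1 else 0) x σ α = Ewt p' p h x σ α - vwt p x σ α i := by
  have h1 : ∑ j, (p' * pact σ x j - p * (h j + if j = i then 1 else 0)) * α j
      = ∑ j, (p' * pact σ x j - p * h j) * α j - p * α i := by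
    rw [eq_sub_iff_add_eq, ← Fintype.sum_ite_eq' i (fun j => p * α j), ← Finset.sum_add_distrib]
    refine Finset.sum_congr rfl fun j _ => ?_
    split_ifs <;> ring
  have h2 : ∑ j, (x j - pact σ x j) * (h j + if j = i then 1 else 0)
      = ∑ j, (x j - pact σ x j) * h j + (x i - pact σ x i) := by
    simp [mul_add, Finset.sum_add_distrib]
  rw [Ewt, Ewt, h1, h2, vwt]
  ring

/-- The summand of `chibarN` indexed by `σ` and `α`. -/
noncomputable def chibarTerm {n : ℕ} (p' p : ℤ) (h x N : Fin n → ℤ) (σ : Equiv.Perm (Fin n))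
    (α : Fin n → ℤ) : LS :=
  (-1 : LS) ^ lexp σ * qpow (Ewt p' p h x σ α) * pochZ (∑ i, N i) *
    ∏ i, invPoch (N i - vwt p x σ α i)

theorem chibarN_eq_sum {n : ℕ} (p' p : ℤ) (h x N : Fin n → ℤ) :
    chibarN n p' p h x N =
      ∑ σ, ∑ᶠ α ∈ {α : Fin n → ℤ | ∑ i, α i = 0}, chibarTerm p' p h x N σ α := rfl

theorem chibarTerm_ne_zero_iff {n : ℕ} {p' p : ℤ} {h x N : Fin n → ℤ}
    {σ : Equiv.Perm (Fin n)} {α : Fin n → ℤ} :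
    chibarTerm p' p h x N σ α ≠ 0 ↔ ∏ i, invPoch (N i - vwt p x σ α i) ≠ 0 := by
  simp only [chibarTerm, ne_eq, mul_eq_zero, qpow_ne_zero, pochZ_ne_zero, or_false,
    pow_eq_zero_iff', neg_eq_zero, one_ne_zero, false_and, false_or]

theorem chibarTerm_recursion {n : ℕ} (p' p : ℤ) (h x : Fin n → ℤ) {N : Fin n → ℤ}
    (hN : 0 ≤ ∑ j, N j) (i : Fin n) (σ : Equiv.Perm (Fin n)) {α : Fin n → ℤ}
    (hα : ∑ j, α j = 0) :
    chibarTerm p' p h x N σ α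
      = qpow (N i) * chibarTerm p' p (fun j => h j + if j = i then 1 else 0) x N σ α
        + (1 - qpow (∑ j, N j))
          * chibarTerm p' p h x (fun j => N j - if j = i then 1 else 0) σ α := by
  have hq : qpow (N i) * qpow (Ewt p' p h x σ α - vwt p x σ α i)
      = qpow (Ewt p' p h x σ α) * qpow (N i - vwt p x σ α i) := by
    rw [← qpow_add, ← qpow_add]
    congr 1
    ring
  have hsum : ∑ j, (N j - if j = i then (1 : ℤ) else 0) = ∑ j, N j - 1 := by
    simp [Finset.sum_sub_distrib]
  have hprod : ∏ j, invPoch ((N j - if j = i then 1 else 0) - vwt p x σ α j)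
      = (1 - qpow (N i - vwt p x σ α i)) * ∏ j, invPoch (N j - vwt p x σ α j) := by
    rw [← prod_invPoch_sub_single (fun j => N j - vwt p x σ α j) i]
    refine Finset.prod_congr rfl fun j _ => ?_
    rw [sub_right_comm]
  have hpoch : (1 - qpow (∑ j, N j)) * (pochZ (∑ j, N j - 1) *
        ∏ j, invPoch ((N j - if j = i then 1 else 0) - vwt p x σ α j))
      = pochZ (∑ j, N j) * ∏ j, invPoch ((N j - if j = i then 1 else 0) - vwt p x σ α j) := by
    rcases hN.eq_or_lt with h0 | hpos
    · rw [prod_invPoch_eq_zero_of_sum_neg (m := fun j => _ - _), mul_zero, mul_zero, mul_zero]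
      rw [Finset.sum_sub_distrib, hsum, sum_vwt p x σ hα]
      omega
    · rw [pochZ_eq_mul_pochZ_sub_one hpos, mul_assoc]
  simp only [chibarTerm, Ewt_add_single, hsum]
  rw [hprod] at hpoch ⊢
  linear_combination (-((-1 : LS) ^ lexp σ) * pochZ (∑ j, N j)
      * ∏ j, invPoch (N j - vwt p x σ α j)) * hq
    - (-1 : LS) ^ lexp σ * qpow (Ewt p' p h x σ α) * hpoch

theorem finite_support_chibarTerm {n : ℕ} {p : ℤ} (hp : p ≠ 0) (p' : ℤ) (h x N : Fin n → ℤ)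
    (σ : Equiv.Perm (Fin n)) :
    ({α : Fin n → ℤ | ∑ i, α i = 0} ∩ Function.support (chibarTerm p' p h x N σ)).Finite := by
  have hinj : Function.Injective (vwt p x σ) := by
    intro α β hαβ
    funext j
    have hj := congrFun hαβ j
    simpa [vwt, hp] using hj
  refine ((Set.finite_Icc (fun j => N j - ∑ k, N k) N).preimage hinj.injOn).subset ?_
  rintro α ⟨hα, hsupp⟩
  have hle : ∀ j, vwt p x σ α j ≤ N j := by
    intro j
    by_contra hlt
    exact chibarTerm_ne_zero_iff.mp hsupp
      (Finset.prod_eq_zero (Finset.mem_univ j) (invPoch_of_neg (by omega)))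
  refine ⟨fun j => ?_, hle⟩
  have hv := sum_vwt p x σ hα
  have hsingle := Finset.single_le_sum (s := Finset.univ) (f := fun k => N k - vwt p x σ α k)
    (fun k _ => sub_nonneg.mpr (hle k)) (Finset.mem_univ j)
  rw [Finset.sum_sub_distrib, hv] at hsingle
  simp only at hsingle ⊢
  omega

theorem infinite_setOf_sum_eq_zero {n : ℕ} (hn : 2 ≤ n) :
    {α : Fin n → ℤ | ∑ i, α i = 0}.Infinite := by
  obtain ⟨m, rfl⟩ : ∃ m, n = m + 2 := ⟨n - 2, by omega⟩
  refine Set.infinite_of_injective_forall_mem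
    (f := fun k : ℤ => (Pi.single 0 k + Pi.single 1 (-k) : Fin (m + 2) → ℤ)) ?_ ?_
  · intro a b hab
    simpa using congrFun hab 0
  · intro k
    simp [Finset.sum_add_distrib]

theorem finsum_chibarTerm_zero {n : ℕ} (hn : 2 ≤ n) (p' : ℤ) (h x N : Fin n → ℤ)
    (σ : Equiv.Perm (Fin n)) :
    ∑ᶠ α ∈ {α : Fin n → ℤ | ∑ i, α i = 0}, chibarTerm p' 0 h x N σ α = 0 := by
  by_cases hprod : ∏ i, invPoch (N i - vwt 0 x σ 0 i) = 0
  · refine finsum_mem_eq_zero_of_forall_eq_zero fun α _ => ?_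
    by_contra hne
    exact chibarTerm_ne_zero_iff.mp hne (by simpa [vwt] using hprod)
  · refine finsum_mem_eq_zero_of_infinite ?_
    rw [Set.inter_eq_left.mpr]
    · exact infinite_setOf_sum_eq_zero hn
    · exact fun α _ => chibarTerm_ne_zero_iff.mpr (by simpa [vwt] using hprod)

/-- Proposition 4.4 (i): for all `h, x ∈ ℤ^n`, `N ∈ ℤ_{≥0}^n` and `i`,
`χ̄^{p',p}_{h,x}[N] = q^{N_i} χ̄^{p',p}_{h+e_i,x}[N] + (1-q^{|N|}) χ̄^{p',p}_{h,x}[N-1_i]`. -/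
theorem chibar_recursion (n : ℕ) [NeZero n] (hn : 2 ≤ n) (p' p : ℤ)
    (h x : Fin n → ℤ) (N : Fin n → ℤ) (hN : ∀ i, 0 ≤ N i) (i : Fin n) :
    chibarN n p' p h x N
      = qpow (N i) * chibarN n p' p (fun j => h j + if j = i then 1 else 0) x N
        + (1 - qpow (∑ j, N j)) * chibarN n p' p h x (fun j => N j - if j = i then 1 else 0) := by
  simp only [chibarN_eq_sum, Finset.mul_sum, ← Finset.sum_add_distrib]
  refine Finset.sum_congr rfl fun σ _ => ?_
  rcases eq_or_ne p 0 with rfl | hp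
  · simp only [finsum_chibarTerm_zero hn, mul_zero, add_zero]
  have hfin := fun h N => finite_support_chibarTerm hp p' h x N σ
  rw [mul_finsum_mem, mul_finsum_mem, ← finsum_mem_add_distrib']
  · exact finsum_mem_congr rfl fun α hα =>
      chibarTerm_recursion p' p h x (Finset.sum_nonneg fun j _ => hN j) i σ hα
  all_goals
    exact (hfin _ _).subset (Set.inter_subset_inter_right _ fun α => right_ne_zero_of_mul)
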